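/- Let l be a positive integer and let u, v : (0,∞) → ℂ be smooth functions with compact support contained in (0,∞). Then ∫_0^∞ ( \overline{u'(r)} v'(r) + (l(l+1)/r^2) \overline{u(r)} v(r) ) dr = ∫_0^∞ \overline{(E_l u)(r)} (E_l v)(r) dr, where (E_l u)(r) = u'(r) + l u(r)/r. That is, the transverse scalar product ⟨u,v⟩_l equals the plain L^2 scalar product of E_l u and E_l v. -/

import Mathlib

open Set MeasureTheory

/-- The first-order differential operation `(E_l u)(r) = u'(r) + l u(r)/r`. -/
noncomputable def Eop (l : ℕ) (u : ℝ → ℂ) : ℝ → ℂ :=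
  fun r => deriv u r + (l : ℂ) * u r / (r : ℂ)

/-- Dividing a smooth function supported in `(0,∞)` by the variable keeps it smooth on the line. -/
theorem contDiff_div_ofReal_of_tsupport_subset_Ioi {n : WithTop ℕ∞} {f : ℝ → ℂ}
    (hf : ContDiff ℝ n f) (hs : tsupport f ⊆ Ioi 0) :
    ContDiff ℝ n (fun r : ℝ => f r / (r : ℂ)) := by
  refine contDiff_iff_contDiffAt.2 fun x => ?_
  by_cases hx : x ∈ tsupport f
  · have hx0 : (x : ℂ) ≠ 0 := by exact_mod_cast (mem_Ioi.1 (hs hx)).ne'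
    have hr : ContDiffAt ℝ n (fun r : ℝ => (r : ℂ)) x := Complex.ofRealCLM.contDiff.contDiffAt
    simp only [div_eq_mul_inv]
    exact hf.contDiffAt.mul (hr.inv hx0)
  · refine (contDiffAt_const (c := (0 : ℂ))).congr_of_eventuallyEq ?_
    filter_upwards [notMem_tsupport_iff_eventuallyEq.1 hx] with y hy
    simp [hy]

/-- For smooth compactly supported `u, v` on `(0,∞)`, the transverse scalar
product `⟨u,v⟩_l` equals the plain `L²` scalar product of `E_l u` and `E_l v`. -/
theorem stmt10 (l : ℕ) (hl : 0 < l) (u v : ℝ → ℂ)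
    (hu : ContDiff ℝ (⊤ : ℕ∞) u) (hv : ContDiff ℝ (⊤ : ℕ∞) v)
    (hcu : HasCompactSupport u) (hcv : HasCompactSupport v)
    (hsu : tsupport u ⊆ Ioi 0) (hsv : tsupport v ⊆ Ioi 0) :
    (∫ r in Ioi (0 : ℝ),
        ((starRingEnd ℂ) (deriv u r) * deriv v r
          + ((l : ℂ) * ((l : ℂ) + 1)) / (r : ℂ) ^ 2 * (starRingEnd ℂ) (u r) * v r))
      = ∫ r in Ioi (0 : ℝ), (starRingEnd ℂ) (Eop l u r) * Eop l v r := by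
  have hu1 : ContDiff ℝ 1 u := hu.of_le (by exact_mod_cast le_top)
  have hv1 : ContDiff ℝ 1 v := hv.of_le (by exact_mod_cast le_top)
  have hc : ContDiff ℝ 1 (fun r => (starRingEnd ℂ) (u r)) := Complex.conjCLE.contDiff.comp hu1
  have hqu := contDiff_div_ofReal_of_tsupport_subset_Ioi hu1 hsu
  have hqv := contDiff_div_ofReal_of_tsupport_subset_Ioi hv1 hsv
  have hcqv : HasCompactSupport (fun r : ℝ => v r / (r : ℂ)) := by
    simp only [div_eq_mul_inv]
    exact hcv.mul_right (f' := fun r : ℝ => (r : ℂ)⁻¹)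
  set w : ℝ → ℂ := fun r => (l : ℂ) * (starRingEnd ℂ) (u r) * (v r / (r : ℂ)) with hw
  have hw1 : ContDiff ℝ 1 w := (contDiff_const.mul hc).mul hqv
  have hcw : HasCompactSupport w := hcqv.mul_left
  have hw0 : ∫ r in Ioi (0 : ℝ), deriv w r = 0 := by
    rw [hcw.integral_Ioi_deriv_eq hw1 0]
    simp [hw]
  have hiw : IntegrableOn (deriv w) (Ioi 0) :=
    ((hw1.continuous_deriv le_rfl).integrable_of_hasCompactSupport hcw.deriv).integrableOn
  have hi1 : Integrable (fun r => (starRingEnd ℂ) (deriv u r) * deriv v r) :=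
    ((Complex.continuous_conj.comp (hu1.continuous_deriv le_rfl)).mul
      (hv1.continuous_deriv le_rfl)).integrable_of_hasCompactSupport hcv.deriv.mul_left
  have hi2 : Integrable (fun r : ℝ =>
      ((l : ℂ) * ((l : ℂ) + 1)) / (r : ℂ) ^ 2 * (starRingEnd ℂ) (u r) * v r) := by
    have h : Integrable (fun r : ℝ => ((l : ℂ) * ((l : ℂ) + 1))
        * (starRingEnd ℂ) (u r / (r : ℂ)) * (v r / (r : ℂ))) :=
      ((continuous_const.mul (Complex.continuous_conj.comp hqu.continuous)).mul
        hqv.continuous).integrable_of_hasCompactSupport hcqv.mul_left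
    convert h using 2 with r
    rw [map_div₀, Complex.conj_ofReal]
    ring
  have hi : IntegrableOn (fun r : ℝ => (starRingEnd ℂ) (deriv u r) * deriv v r
      + ((l : ℂ) * ((l : ℂ) + 1)) / (r : ℂ) ^ 2 * (starRingEnd ℂ) (u r) * v r) (Ioi 0) :=
    (hi1.add hi2).integrableOn
  rw [← add_zero (∫ r in Ioi (0 : ℝ), _), ← hw0,
    ← integral_add hi hiw]
  refine setIntegral_congr_fun measurableSet_Ioi fun r hr => ?_
  have hr0 : (r : ℂ) ≠ 0 := by exact_mod_cast (mem_Ioi.1 hr).ne'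
  have hdu : HasDerivAt (fun r => (starRingEnd ℂ) (u r)) ((starRingEnd ℂ) (deriv u r)) r :=
    (hu1.differentiable one_ne_zero r).hasDerivAt.star
  have hdv := (hv1.differentiable one_ne_zero r).hasDerivAt
  have hdw : deriv w r = _ :=
    ((hdu.const_mul (l : ℂ)).mul (hdv.div (HasDerivAt.ofReal_comp (hasDerivAt_id r)) hr0)).deriv
  simp only [hdw, Eop, map_add, map_mul, map_div₀, Complex.conj_ofReal, map_natCast, id,
    Complex.ofReal_one, Pi.div_apply]
  field_simp
  ring
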